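/- There is an absolute constant C > 0 with the following property. Let 0 < ε < 1, let n ≥ 2, let q₁, …, q_n ∈ ℝ^d, let t ≥ C·(log n)/ε², and let G be a random t×d real matrix whose entries are independent Gaussian random variables with mean 0 and variance 1/t. Then with probability at least 1 − 1/n, simultaneously for all i ∈ {1,…,n} it holds that (1 − ε)‖qᵢ‖₂ ≤ ‖G qᵢ‖₂ ≤ (1 + ε)‖qᵢ‖₂. -/

import Mathlib

open MeasureTheory ProbabilityTheory Matrix
open scoped NNReal

/-- The Euclidean norm of a vector in `ℝ^n`. -/
noncomputable def euclNorm {n : ℕ} (x : Fin n → ℝ) : ℝ := Real.sqrt (∑ i, (x i) ^ 2)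

/-- Rows of a random matrix with independent entries are independent. -/
lemma iIndepFun_rows_pi {ι κ α : Type*} [Fintype ι] [Fintype κ] [MeasurableSpace α]
    (μ : Measure α) [IsProbabilityMeasure μ] :
    iIndepFun (fun (i : ι) (ω : ι × κ → α) (j : κ) => ω (i, j)) (Measure.pi fun _ => μ) := by
  have hrow (i : ι) : (Measure.pi fun _ : ι × κ => μ).map (fun ω (j : κ) => ω (i, j)) =
      Measure.pi fun _ : κ => μ := by
    have h := (iIndepFun_pi (μ := fun _ : ι × κ => μ) (X := fun _ x => x)
      (fun _ => aemeasurable_id)).precomp (Prod.mk_right_injective i : (Prod.mk i : κ → _).Injective)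
    rw [h.map_fun_eq_pi_map fun _ => Measurable.aemeasurable (by fun_prop)]
    congr 1 with j : 1
    exact (measurePreserving_eval (fun _ : ι × κ => μ) (i, j)).map_eq
  rw [iIndepFun_iff_map_fun_eq_pi_map fun _ => Measurable.aemeasurable (by fun_prop)]
  simp_rw [hrow]
  have h := Measure.infinitePi_map_curry (fun (_ : ι) (_ : κ) => μ)
  simp only [Measure.infinitePi_eq_pi] at h
  exact h

lemma map_sum_mul_pi_gaussianReal {ι κ : Type*} [Fintype ι] [Fintype κ] (v : ℝ≥0) (q : κ → ℝ)
    (i : ι) :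
    (Measure.pi fun _ : ι × κ => gaussianReal 0 v).map (fun ω => ∑ j, q j * ω (i, j)) =
      gaussianReal 0 (v * ∑ j, ‖q j‖₊ ^ 2) := by
  have h := ((iIndepFun_pi (μ := fun _ : ι × κ => gaussianReal 0 v) (X := fun _ x => x)
      (fun _ => aemeasurable_id)).precomp
      (Prod.mk_right_injective i : (Prod.mk i : κ → _).Injective)).comp
      (fun j x => q j * x) (by fun_prop)
  have hmap (j : κ) : (Measure.pi fun _ : ι × κ => gaussianReal 0 v).map
      (fun ω => q j * ω (i, j)) = gaussianReal 0 (‖q j‖₊ ^ 2 * v) := by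
    have := Measure.map_map (μ := Measure.pi fun _ : ι × κ => gaussianReal 0 v)
      (g := fun x => q j * x) (f := fun ω => ω (i, j)) (by fun_prop) (by fun_prop)
    rw [(measurePreserving_eval (fun _ : ι × κ => gaussianReal 0 v) (i, j)).map_eq,
      gaussianReal_map_const_mul, mul_zero] at this
    rw [Function.comp_def] at this
    rw [← this]
    congr 2
    ext
    simp
  apply Measure.ext_of_charFun
  have hs := h.charFun_map_fun_sum_eq_prod (fun j => by
    exact Measurable.aemeasurable (by fun_prop))
  simp only [Function.comp_def] at hs
  rw [hs]
  simp_rw [hmap]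
  ext s
  simp only [Finset.prod_apply, charFun_gaussianReal, ← Complex.exp_sum]
  congr 1
  simp only [Complex.ofReal_zero, mul_zero, zero_mul, zero_sub, NNReal.coe_mul, NNReal.coe_sum,
    Complex.ofReal_mul, Complex.ofReal_sum, Finset.sum_neg_distrib, ← Finset.sum_div,
    ← Finset.sum_mul]
  ring

lemma mgf_sq_gaussianReal {v : ℝ≥0} (hv : v ≠ 0) {r : ℝ} (hr : 0 < r) :
    mgf (fun x => x ^ 2) (gaussianReal 0 v) ((1 - (r ^ 2)⁻¹) / (2 * v)) = r := by
  have hv' : (0 : ℝ) < v := by positivity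
  rw [mgf, integral_gaussianReal_eq_integral_smul hv]
  have h (x : ℝ) : gaussianPDFReal 0 v x • Real.exp ((1 - (r ^ 2)⁻¹) / (2 * v) * x ^ 2) =
      (√(2 * Real.pi * v))⁻¹ * Real.exp (-(2 * v * r ^ 2)⁻¹ * x ^ 2) := by
    rw [gaussianPDFReal, smul_eq_mul, mul_assoc, ← Real.exp_add]
    congr 2
    field_simp
    ring
  simp_rw [h]
  rw [integral_const_mul, integral_gaussian]
  have : Real.pi / (2 * v * r ^ 2)⁻¹ = (2 * Real.pi * v) * r ^ 2 := by
    field_simp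
  rw [this, Real.sqrt_mul (x := 2 * Real.pi * v) (by positivity), Real.sqrt_sq hr.le]
  have : √(2 * Real.pi * v) ≠ 0 := by positivity
  field_simp

section Chernoff

variable {Ω ι : Type*} [MeasurableSpace Ω] {P : Measure Ω} [Fintype ι] {X : ι → Ω → ℝ} {v : ℝ≥0}

lemma mgf_sum_sq_gaussian (hX : iIndepFun X P) (hm : ∀ i, Measurable (X i))
    (hlaw : ∀ i, P.map (X i) = gaussianReal 0 v) (hv : v ≠ 0) {r : ℝ} (hr : 0 < r) :
    mgf (fun ω => ∑ i, X i ω ^ 2) P ((1 - (r ^ 2)⁻¹) / (2 * v)) = r ^ Fintype.card ι := by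
  have h := (hX.comp (fun _ x => x ^ 2) (by fun_prop)).mgf_sum
    (t := (1 - (r ^ 2)⁻¹) / (2 * v)) (by fun_prop) Finset.univ
  have hi (i : ι) : mgf ((fun x => x ^ 2) ∘ X i) P ((1 - (r ^ 2)⁻¹) / (2 * v)) = r := by
    rw [← mgf_map (hm i).aemeasurable (by fun_prop), hlaw, mgf_sq_gaussianReal hv hr]
  simp_rw [hi] at h
  rw [Finset.prod_const, Finset.card_univ] at h
  rw [← h]
  congr 1
  ext ω
  simp

lemma exp_mul_pow_le (t : ℕ) (hv : v ≠ 0) {r : ℝ} (hr : 0 < r) :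
    Real.exp (-((1 - (r ^ 2)⁻¹) / (2 * v)) * (r ^ 2 * (t * v))) * r ^ t ≤
      Real.exp (-(t * (r - 1) ^ 2 / 2)) := by
  have hv' : (v : ℝ) ≠ 0 := by positivity
  have h : -((1 - (r ^ 2)⁻¹) / (2 * v)) * (r ^ 2 * (t * v)) = t * ((1 - r ^ 2) / 2) := by
    field_simp
    ring
  rw [h, ← Real.exp_log (pow_pos hr t), ← Real.exp_add, Real.exp_le_exp, Real.log_pow]
  have := mul_le_mul_of_nonneg_left (Real.log_le_sub_one_of_pos hr) (Nat.cast_nonneg (α := ℝ) t)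
  linarith

lemma integrable_exp_sum_sq_gaussian (hX : iIndepFun X P) (hm : ∀ i, Measurable (X i))
    (hlaw : ∀ i, P.map (X i) = gaussianReal 0 v) (hv : v ≠ 0) {r : ℝ} (hr : 0 < r) :
    Integrable (fun ω => Real.exp ((1 - (r ^ 2)⁻¹) / (2 * v) * ∑ i, X i ω ^ 2)) P := by
  apply Integrable.of_integral_ne_zero
  have := mgf_sum_sq_gaussian hX hm hlaw hv hr
  rw [mgf] at this
  rw [this]
  positivity

/-- Upper tail bound for a sum of squares of independent centred Gaussians. -/
lemma measureReal_le_sum_sq_gaussian (hX : iIndepFun X P) (hm : ∀ i, Measurable (X i))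
    (hlaw : ∀ i, P.map (X i) = gaussianReal 0 v) (hv : v ≠ 0) {r : ℝ} (hr : 1 ≤ r) :
    P.real {ω | r ^ 2 * (Fintype.card ι * v) ≤ ∑ i, X i ω ^ 2} ≤
      Real.exp (-(Fintype.card ι * (r - 1) ^ 2 / 2)) := by
  have := hX.isProbabilityMeasure
  have hr0 : 0 < r := by linarith
  refine (measure_ge_le_exp_mul_mgf _ ?_
    (integrable_exp_sum_sq_gaussian hX hm hlaw hv hr0)).trans ?_
  · have : (r ^ 2)⁻¹ ≤ 1 := inv_le_one_of_one_le₀ (one_le_pow₀ hr)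
    exact div_nonneg (by linarith) (by positivity)
  · rw [mgf_sum_sq_gaussian hX hm hlaw hv hr0]
    exact exp_mul_pow_le _ hv hr0

/-- Lower tail bound for a sum of squares of independent centred Gaussians. -/
lemma measureReal_sum_sq_gaussian_le (hX : iIndepFun X P) (hm : ∀ i, Measurable (X i))
    (hlaw : ∀ i, P.map (X i) = gaussianReal 0 v) (hv : v ≠ 0) {r : ℝ} (hr0 : 0 < r) (hr : r ≤ 1) :
    P.real {ω | ∑ i, X i ω ^ 2 ≤ r ^ 2 * (Fintype.card ι * v)} ≤
      Real.exp (-(Fintype.card ι * (r - 1) ^ 2 / 2)) := by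
  have := hX.isProbabilityMeasure
  refine (measure_le_le_exp_mul_mgf _ ?_
    (integrable_exp_sum_sq_gaussian hX hm hlaw hv hr0)).trans ?_
  · have : 1 ≤ (r ^ 2)⁻¹ := (one_le_inv₀ (by positivity)).2 (pow_le_one₀ hr0.le hr)
    exact div_nonpos_of_nonpos_of_nonneg (by linarith) (by positivity)
  · rw [mgf_sum_sq_gaussian hX hm hlaw hv hr0]
    exact exp_mul_pow_le _ hv hr0

end Chernoff

/-- A scaled Gaussian matrix distorts the norm of a fixed vector by more than `ε` with
exponentially small probability. -/
lemma measureReal_euclNorm_mulVec_le {t d : ℕ} (ht : t ≠ 0) (q : Fin d → ℝ) {ε : ℝ} (hε : 0 < ε)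
    (hε1 : ε < 1) :
    (Measure.pi fun _ : Fin t × Fin d => gaussianReal 0 (t : ℝ≥0)⁻¹).real
      {ω | ¬((1 - ε) * euclNorm q ≤ euclNorm ((Matrix.of fun a b => ω (a, b)).mulVec q) ∧
        euclNorm ((Matrix.of fun a b => ω (a, b)).mulVec q) ≤ (1 + ε) * euclNorm q)} ≤
      2 * Real.exp (-(t * ε ^ 2 / 2)) := by
  set P := Measure.pi fun _ : Fin t × Fin d => gaussianReal 0 (t : ℝ≥0)⁻¹ with hP
  set X : Fin t → (Fin t × Fin d → ℝ) → ℝ := fun a ω => ∑ b, q b * ω (a, b) with hXdef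
  have hnorm (ω : Fin t × Fin d → ℝ) :
      euclNorm ((Matrix.of fun a b => ω (a, b)).mulVec q) = √(∑ a, X a ω ^ 2) := by
    simp [euclNorm, Matrix.mulVec, dotProduct, hXdef, mul_comm]
  rcases eq_or_ne q 0 with rfl | hq
  · simp [euclNorm]
    positivity
  set v : ℝ≥0 := (t : ℝ≥0)⁻¹ * ∑ b, ‖q b‖₊ ^ 2 with hvdef
  have hS : 0 < ∑ b, ‖q b‖₊ ^ 2 := by
    obtain ⟨b, hb⟩ := Function.ne_iff.1 hq
    exact Finset.sum_pos' (fun _ _ => by positivity)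
      ⟨b, Finset.mem_univ b, pow_pos (nnnorm_pos.2 hb) 2⟩
  have hv : v ≠ 0 := by positivity
  have htv : (Fintype.card (Fin t) : ℝ) * v = ∑ b, q b ^ 2 := by
    simp [hvdef, ht]
  have hX : iIndepFun X P := (iIndepFun_rows_pi (ι := Fin t) (κ := Fin d) _).comp
    (fun _ x => ∑ b, q b * x b) (by fun_prop)
  have hm (a : Fin t) : Measurable (X a) := by fun_prop
  have hlaw (a : Fin t) : P.map (X a) = gaussianReal 0 v := map_sum_mul_pi_gaussianReal _ q a
  have hup := measureReal_le_sum_sq_gaussian hX hm hlaw hv (r := 1 + ε) (by linarith)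
  have hlo := measureReal_sum_sq_gaussian_le hX hm hlaw hv (r := 1 - ε) (by linarith) (by linarith)
  rw [htv, Fintype.card_fin] at hup hlo
  have hsub : {ω | ¬((1 - ε) * euclNorm q ≤ euclNorm ((Matrix.of fun a b => ω (a, b)).mulVec q) ∧
      euclNorm ((Matrix.of fun a b => ω (a, b)).mulVec q) ≤ (1 + ε) * euclNorm q)} ⊆
      {ω | ∑ a, X a ω ^ 2 ≤ (1 - ε) ^ 2 * ∑ b, q b ^ 2} ∪
      {ω | (1 + ε) ^ 2 * ∑ b, q b ^ 2 ≤ ∑ a, X a ω ^ 2} := by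
    intro ω hω
    have hmul {c : ℝ} (hc : 0 ≤ c) : c * euclNorm q = √(c ^ 2 * ∑ b, q b ^ 2) := by
      rw [Real.sqrt_mul (sq_nonneg c), Real.sqrt_sq hc, euclNorm]
    simp only [Set.mem_ofPred_eq, hnorm, not_and_or, not_le, hmul (sub_nonneg.2 hε1.le),
      hmul (add_nonneg zero_le_one hε.le)] at hω
    exact hω.imp (fun h => (lt_of_not_ge fun h' => h.not_ge (Real.sqrt_le_sqrt h')).le)
      (fun h => (lt_of_not_ge fun h' => h.not_ge (Real.sqrt_le_sqrt h')).le)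
  calc _ ≤ _ := measureReal_mono hsub
    _ ≤ _ := measureReal_union_le _ _
    _ ≤ _ := add_le_add hlo hup
    _ = _ := by ring_nf

/-- Johnson–Lindenstrauss: a `t × d` matrix of i.i.d. Gaussian entries
of mean `0` and variance `1/t`, with `t ≥ C (log n)/ε²`, preserves the Euclidean norms
of `n` fixed points up to `1 ± ε`, with probability at least `1 − 1/n`. -/
theorem stmt4 :
    ∃ C : ℝ, 0 < C ∧
      ∀ (ε : ℝ), 0 < ε → ε < 1 →
      ∀ (n : ℕ), 2 ≤ n →
      ∀ (d : ℕ) (q : Fin n → (Fin d → ℝ)),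
      ∀ (t : ℕ), (t : ℝ) ≥ C * Real.log n / ε ^ 2 →
        (Measure.pi fun _ : Fin t × Fin d => gaussianReal 0 (t : ℝ≥0)⁻¹)
          {ω | ∀ i : Fin n,
            (1 - ε) * euclNorm (q i)
                ≤ euclNorm ((Matrix.of fun a b => ω (a, b)).mulVec (q i)) ∧
            euclNorm ((Matrix.of fun a b => ω (a, b)).mulVec (q i))
                ≤ (1 + ε) * euclNorm (q i)}
          ≥ ENNReal.ofReal (1 - 1 / n) := by
  refine ⟨6, by norm_num, fun ε hε hε1 n hn d q t ht => ?_⟩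
  have hn' : (2 : ℝ) ≤ n := by exact_mod_cast hn
  have hn0 : (0 : ℝ) < n := by linarith
  have hlog : 0 < Real.log n := Real.log_pos (by linarith)
  have ht0 : t ≠ 0 := by
    rintro rfl
    have : 0 < 6 * Real.log n / ε ^ 2 := by positivity
    simp only [Nat.cast_zero] at ht
    linarith
  have htε : 3 * Real.log n ≤ t * ε ^ 2 / 2 := by
    have := (div_le_iff₀ (by positivity)).1 ht
    linarith
  have hexp : Real.exp (-(t * ε ^ 2 / 2)) ≤ ((n : ℝ) ^ 3)⁻¹ := by
    rw [← Real.exp_log (pow_pos hn0 3), ← Real.exp_neg, Real.exp_le_exp, Real.log_pow]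
    push_cast
    linarith
  set P := Measure.pi fun _ : Fin t × Fin d => gaussianReal 0 (t : ℝ≥0)⁻¹ with hP
  set E : Fin n → Set (Fin t × Fin d → ℝ) := fun i =>
    {ω | (1 - ε) * euclNorm (q i) ≤ euclNorm ((Matrix.of fun a b => ω (a, b)).mulVec (q i)) ∧
      euclNorm ((Matrix.of fun a b => ω (a, b)).mulVec (q i)) ≤ (1 + ε) * euclNorm (q i)}
    with hE
  have hEm (i : Fin n) : MeasurableSet (E i) := by
    have : Measurable fun ω : Fin t × Fin d → ℝ =>
        euclNorm ((Matrix.of fun a b => ω (a, b)).mulVec (q i)) := by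
      simp only [euclNorm, Matrix.mulVec, dotProduct, Matrix.of_apply]
      fun_prop
    exact (measurableSet_le measurable_const this).inter (measurableSet_le this measurable_const)
  have hset : {ω | ∀ i : Fin n,
      (1 - ε) * euclNorm (q i) ≤ euclNorm ((Matrix.of fun a b => ω (a, b)).mulVec (q i)) ∧
      euclNorm ((Matrix.of fun a b => ω (a, b)).mulVec (q i)) ≤ (1 + ε) * euclNorm (q i)} =
      ⋂ i, E i := by
    ext ω
    simp [hE]
  rw [hset, ge_iff_le, ← ofReal_measureReal]
  apply ENNReal.ofReal_le_ofReal
  have hcompl : P.real (⋂ i, E i)ᶜ ≤ 1 / n := by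
    rw [Set.compl_iInter]
    calc P.real (⋃ i, (E i)ᶜ) ≤ ∑ i, P.real (E i)ᶜ := measureReal_iUnion_fintype_le _
      _ ≤ ∑ _i : Fin n, 2 * ((n : ℝ) ^ 3)⁻¹ := Finset.sum_le_sum fun i _ =>
          (measureReal_euclNorm_mulVec_le ht0 (q i) hε hε1).trans (by gcongr)
      _ = 2 / n * (1 / n) := by
          simp only [Finset.sum_const, Finset.card_univ, Fintype.card_fin, nsmul_eq_mul]
          field_simp
      _ ≤ 1 * (1 / n) := by
          gcongr
          exact (div_le_one hn0).2 hn'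
      _ = 1 / n := one_mul _
  rw [probReal_compl_eq_one_sub (MeasurableSet.iInter hEm)] at hcompl
  linarith
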